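/- arXiv:2308.11102 — 4 statements merged into one kernel-verified Lean document; each statement's English description precedes it below -/
import Mathlib

section
/- For every k ∈ ℂ, the determinant of M₂ − k·I₄ equals (1 − k)²·(k² − ζ₆·k + ζ₆²), where M₂ is the 4×4 matrix with rows (1,0,0,0), (0,1,0,0), (0,0,(2ζ₆−1)/3, (−ζ₆−1)/3), (0,0,(4ζ₆−2)/3, (ζ₆+1)/3). Consequently M₂ − k·I₄ is singular exactly when k = 1 or k = ζ₃. -/
open Matrix Complex

noncomputable def zeta6 : ℂ := (1 + Real.sqrt 3 * Complex.I) / 2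
noncomputable def zeta3 : ℂ := (-1 + Real.sqrt 3 * Complex.I) / 2

noncomputable def M1 : Matrix (Fin 4) (Fin 4) ℂ :=
  !![1, 0, 0, 0; 0, 1, 0, 0; 0, 0, 1, 0; 0, 0, 0, zeta3]

noncomputable def M2 : Matrix (Fin 4) (Fin 4) ℂ :=
  !![1, 0, 0, 0; 0, 1, 0, 0;
     0, 0, (2 * zeta6 - 1) / 3, (-zeta6 - 1) / 3;
     0, 0, (4 * zeta6 - 2) / 3, (zeta6 + 1) / 3]

noncomputable def M3 : Matrix (Fin 4) (Fin 4) ℂ :=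
  !![1, 0, 0, 0; 0, 1, 0, 0;
     0, 0, (2 * zeta6 - 1) / 3, (-zeta6 + 2) / 3;
     0, 0, (-2 * zeta6 + 4) / 3, (zeta6 + 1) / 3]

noncomputable def M4 : Matrix (Fin 4) (Fin 4) ℂ :=
  !![1, 0, 0, 0; 0, 1, 0, 0;
     0, 0, (2 * zeta6 - 1) / 3, (2 * zeta6 - 1) / 3;
     0, 0, (-2 * zeta6 - 2) / 3, (zeta6 + 1) / 3]

noncomputable def M5 : Matrix (Fin 4) (Fin 4) ℂ :=
  !![1, 0, 0, 0; 0, zeta3, 0, 0; 0, 0, 1, 0; 0, 0, 0, 1]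

noncomputable def M6 : Matrix (Fin 4) (Fin 4) ℂ :=
  !![(2 * zeta6 - 1) / 3, (-zeta6 - 1) / 3, 0, 0;
     (4 * zeta6 - 2) / 3, (zeta6 + 1) / 3, 0, 0;
     0, 0, 1, 0; 0, 0, 0, 1]

noncomputable def M7 : Matrix (Fin 4) (Fin 4) ℂ :=
  !![(2 * zeta6 - 1) / 3, (-zeta6 + 2) / 3, 0, 0;
     (-2 * zeta6 + 4) / 3, (zeta6 + 1) / 3, 0, 0;
     0, 0, 1, 0; 0, 0, 0, 1]

noncomputable def M8 : Matrix (Fin 4) (Fin 4) ℂ :=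
  !![(2 * zeta6 - 1) / 3, (2 * zeta6 - 1) / 3, 0, 0;
     (-2 * zeta6 - 2) / 3, (zeta6 + 1) / 3, 0, 0;
     0, 0, 1, 0; 0, 0, 0, 1]

theorem zeta6_sq : zeta6 ^ 2 = zeta6 - 1 := by
  have h : (Real.sqrt 3 : ℂ) ^ 2 = 3 := by
    rw [← Complex.ofReal_pow, Real.sq_sqrt (by norm_num)]
    norm_num
  unfold zeta6
  linear_combination (Complex.I ^ 2 / 4) * h + (3 / 4) * Complex.I_sq

theorem zeta3_eq_zeta6_sub_one : zeta3 = zeta6 - 1 := by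
  unfold zeta3 zeta6
  ring

theorem det_M2_sub_k_smul_one (k : ℂ) :
    (M2 - k • (1 : Matrix (Fin 4) (Fin 4) ℂ)).det
      = (1 - k) ^ 2 * (k ^ 2 - zeta6 * k + zeta6 ^ 2) ∧
    ((M2 - k • (1 : Matrix (Fin 4) (Fin 4) ℂ)).det = 0 ↔ k = 1 ∨ k = zeta3) := by
  have hdet : (M2 - k • (1 : Matrix (Fin 4) (Fin 4) ℂ)).det
      = (1 - k) ^ 2 * (k ^ 2 - zeta6 * k + zeta6 ^ 2) := by
    have hM : M2 - k • (1 : Matrix (Fin 4) (Fin 4) ℂ) =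
        !![1 - k, 0, 0, 0; 0, 1 - k, 0, 0;
          0, 0, (2 * zeta6 - 1) / 3 - k, (-zeta6 - 1) / 3;
          0, 0, (4 * zeta6 - 2) / 3, (zeta6 + 1) / 3 - k] := by
      ext i j
      fin_cases i <;> fin_cases j <;> simp [M2]
    rw [hM]
    simp [Matrix.det_succ_row_zero, Fin.sum_univ_succ, Fin.succAbove]
    linear_combination (-(1 - k) ^ 2 / 3) * zeta6_sq
  refine ⟨hdet, ?_⟩
  have hfactor : (1 - k) ^ 2 * (k ^ 2 - zeta6 * k + zeta6 ^ 2)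
      = (k - 1) ^ 3 * (k - zeta3) := by
    rw [zeta3_eq_zeta6_sub_one]
    linear_combination (1 - k) ^ 2 * zeta6_sq
  rw [hdet, hfactor, mul_eq_zero, pow_eq_zero_iff three_ne_zero, sub_eq_zero, sub_eq_zero]
end

section
/- Let F(X,Y,Z,W) := X⁴ + Z⁴ + XY³ + ZW³. For each i ∈ {1,…,8} and every vector v ∈ ℂ⁴, F(Mᵢ·v) = F(v); that is, each of the eight matrices Mᵢ preserves the quartic form defining the surface S₈, so each σᵢ is an automorphism of S₈. -/
open Matrix Complex

noncomputable def F (v : Fin 4 → ℂ) : ℂ :=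
  v 0 ^ 4 + v 2 ^ 4 + v 0 * v 1 ^ 3 + v 2 * v 3 ^ 3

/-- The binary quartic form `x ^ 4 + x * y ^ 3`, two copies of which make up `F`. -/
def binaryQuartic (x y : ℂ) : ℂ := x ^ 4 + x * y ^ 3

theorem F_eq_binaryQuartic (v : Fin 4 → ℂ) :
    F v = binaryQuartic (v 0) (v 1) + binaryQuartic (v 2) (v 3) := by
  simp only [F, binaryQuartic]
  ring

theorem ofReal_sqrt_three_sq : ((Real.sqrt 3 : ℝ) : ℂ) ^ 2 = 3 := by
  rw [← Complex.ofReal_pow, Real.sq_sqrt (by norm_num)]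
  norm_num

theorem zeta3_pow_three : zeta3 ^ 3 = 1 := by
  rw [zeta3_eq_zeta6_sub_one]
  linear_combination (zeta6 - 2) * zeta6_sq

theorem binaryQuartic_zeta3 (x y : ℂ) : binaryQuartic x (zeta3 * y) = binaryQuartic x y := by
  unfold binaryQuartic
  linear_combination x * y ^ 3 * zeta3_pow_three

theorem binaryQuartic_M2_block (x y : ℂ) :
    binaryQuartic ((2 * zeta6 - 1) / 3 * x + (-zeta6 - 1) / 3 * y)
      ((4 * zeta6 - 2) / 3 * x + (zeta6 + 1) / 3 * y) = binaryQuartic x y := by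
  have h := zeta6_sq
  unfold binaryQuartic
  grind

theorem binaryQuartic_M3_block (x y : ℂ) :
    binaryQuartic ((2 * zeta6 - 1) / 3 * x + (-zeta6 + 2) / 3 * y)
      ((-2 * zeta6 + 4) / 3 * x + (zeta6 + 1) / 3 * y) = binaryQuartic x y := by
  have h := zeta6_sq
  unfold binaryQuartic
  grind

theorem binaryQuartic_M4_block (x y : ℂ) :
    binaryQuartic ((2 * zeta6 - 1) / 3 * x + (2 * zeta6 - 1) / 3 * y)
      ((-2 * zeta6 - 2) / 3 * x + (zeta6 + 1) / 3 * y) = binaryQuartic x y := by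
  have h := zeta6_sq
  unfold binaryQuartic
  grind

theorem galois_generators_preserve_quartic :
    ∀ M ∈ [M1, M2, M3, M4, M5, M6, M7, M8],
      ∀ v : Fin 4 → ℂ, F (M.mulVec v) = F v := by
  simp only [List.forall_mem_cons, List.not_mem_nil, false_imp_iff, implies_true, and_true]
  refine ⟨?_, ?_, ?_, ?_, ?_, ?_, ?_, ?_⟩ <;> intro v <;>
    simp [F_eq_binaryQuartic, M1, M2, M3, M4, M5, M6, M7, M8, dotProduct,
      Fin.sum_univ_four, -neg_mul, binaryQuartic_zeta3,
      binaryQuartic_M2_block, binaryQuartic_M3_block, binaryQuartic_M4_block]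
end

section
/- For every nonzero vector v = (v₀,v₁,v₂,v₃) ∈ ℂ⁴, there exists λ ∈ ℂ with M₂·v = λ·v if and only if either 2v₂ + ζ₆·v₃ = 0, or v is a scalar multiple of (0,0,ζ₆,1). In other words, the fixed locus in ℙ³ of the projective automorphism induced by M₂ is the disjoint union of the plane {2Z + ζ₆W = 0} and the isolated point [0:0:ζ₆:1]. -/
open Matrix Complex

theorem zeta6_ne_two : zeta6 - 2 ≠ 0 := by
  intro h
  have h3 : (3 : ℂ) = 0 := by
    linear_combination zeta6_sq - (zeta6 + 1) * h
  norm_num at h3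

theorem M2_mulVec_eq_smul_iff (v : Fin 4 → ℂ) (lam : ℂ) :
    M2.mulVec v = lam • v ↔
      v 0 = lam * v 0 ∧ v 1 = lam * v 1 ∧
      (2 * zeta6 - 1) / 3 * v 2 + (-zeta6 - 1) / 3 * v 3 = lam * v 2 ∧
      (4 * zeta6 - 2) / 3 * v 2 + (zeta6 + 1) / 3 * v 3 = lam * v 3 := by
  simp [funext_iff, Fin.forall_fin_succ, M2, dotProduct, Fin.sum_univ_succ]

theorem M2_projective_fixed_locus (v : Fin 4 → ℂ) (hv : v ≠ 0) :
    (∃ lam : ℂ, M2.mulVec v = lam • v) ↔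
      (2 * v 2 + zeta6 * v 3 = 0 ∨ ∃ c : ℂ, v = c • ![0, 0, zeta6, 1]) := by
  have hz := zeta6_sq
  simp only [M2_mulVec_eq_smul_iff]
  constructor
  · rintro ⟨lam, h0, h1, h2, h3⟩
    refine or_iff_not_imp_left.mpr fun hp => ?_
    have hlam : lam - (zeta6 - 1) = 0 := by
      refine (mul_eq_zero.mp ?_).resolve_right hp
      linear_combination -2 * h2 - zeta6 * h3 + (4 * v 2 - 2 * v 3) / 3 * hz
    have hne : lam - 1 ≠ 0 := fun h => zeta6_ne_two (by linear_combination h - hlam)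
    have e0 : v 0 = 0 :=
      (mul_eq_zero.mp (by linear_combination -h0 : (lam - 1) * v 0 = 0)).resolve_left hne
    have e1 : v 1 = 0 :=
      (mul_eq_zero.mp (by linear_combination -h1 : (lam - 1) * v 1 = 0)).resolve_left hne
    have e2 : v 2 - zeta6 * v 3 = 0 := by
      refine (mul_eq_zero.mp ?_).resolve_left hne
      linear_combination -h2 + zeta6 * h3 - (4 * v 2 + v 3) / 3 * hz
    refine ⟨v 3, ?_⟩
    ext i
    fin_cases i
    · simpa using e0
    · simpa using e1
    · simpa [mul_comm] using sub_eq_zero.mp e2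
    · simp
  · rintro (hp | ⟨c, rfl⟩)
    · refine ⟨1, by simp, by simp, ?_, ?_⟩
      · linear_combination (zeta6 - 2) / 3 * hp - v 3 / 3 * hz
      · linear_combination (2 * zeta6 - 1) / 3 * hp - 2 * v 3 / 3 * hz
    · refine ⟨zeta6 - 1, by simp, by simp, ?_, ?_⟩
      · simp
        linear_combination -c / 3 * hz
      · simp
        linear_combination 4 * c / 3 * hz
end

section
/- One has (M₁·M₃)³ = diag(1,1,−1,−1) in GL₄(ℂ). Consequently, the projective automorphism σ := (σ₁∘σ₃)³ of ℙ³ is given by [X:Y:Z:W] ↦ [X:Y:−Z:−W]. -/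
open Matrix Complex

theorem M1_mul_M3 :
    M1 * M3 = !![1, 0, 0, 0; 0, 1, 0, 0;
      0, 0, (2 * zeta6 - 1) / 3, (-zeta6 + 2) / 3;
      0, 0, (4 * zeta6 - 2) / 3, (zeta6 - 2) / 3] := by
  have h := zeta6_sq
  ext i j
  fin_cases i <;> fin_cases j <;>
    simp [M1, M3, Matrix.mul_apply, Fin.sum_univ_four, zeta3_eq_zeta6_sub_one] <;> grind

theorem M1_mul_M3_cubed :
    (M1 * M3) ^ 3 = !![1, 0, 0, 0; 0, 1, 0, 0; 0, 0, -1, 0; 0, 0, 0, -1] := by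
  have h := zeta6_sq
  rw [M1_mul_M3, pow_three]
  ext i j
  fin_cases i <;> fin_cases j <;>
    simp [Matrix.mul_apply, Fin.sum_univ_four] <;> grind
end
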